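/- For every finite DAG G = (V, E) and every subset U ⊆ V, the LSCA closure is idempotent, L∞(L∞(U)) = L∞(U); consequently, a node v belongs to L∞(U) if and only if v forms a Λ-structure over (L∞(U), L∞(U)). -/

import Mathlib

open scoped Classical

/-! ## Directed graphs, paths, ancestors -/

/-- A directed graph (given by its edge relation) is acyclic if no node is
reachable from itself by a non-trivial directed walk. -/
def Acyclic {V : Type} (E : V → V → Prop) : Prop :=
  ∀ v : V, ¬ Relation.TransGen E v v

/-- `IsPath E a b p` : the list `p` is a directed path from `a` to `b` in the
graph with edge relation `E` (a path is a nonempty list of nodes in which each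
node has an edge to the next; a single-node path is trivial). -/
def IsPath {V : Type} (E : V → V → Prop) (a b : V) (p : List V) : Prop :=
  p.Chain' E ∧ p.head? = some a ∧ p.getLast? = some b

/-- Descendants of `v` (every node is a descendant of itself). -/
def De {V : Type} (E : V → V → Prop) (v : V) : Set V :=
  {u | Relation.ReflTransGen E v u}

/-- Ancestors of `v` (every node is an ancestor of itself). -/
def An {V : Type} (E : V → V → Prop) (v : V) : Set V :=
  {u | Relation.ReflTransGen E u v}

/-- Parents of `v`. -/
def Pa {V : Type} (E : V → V → Prop) (v : V) : Set V :=
  {p | E p v}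

/-! ## Strict common ancestors, LSCAs, and the LSCA closure -/

/-- `v` is a strict common ancestor of `x` and `y` : there is a path from `v`
to `x` not containing `y`, and a path from `v` to `y` not containing `x`. -/
def SCA {V : Type} (E : V → V → Prop) (x y : V) : Set V :=
  {v | (∃ p, IsPath E v x p ∧ y ∉ p) ∧ (∃ p, IsPath E v y p ∧ x ∉ p)}

/-- `v` is a lowest strict common ancestor of `x` and `y` : it is a strict
common ancestor, and no strict common ancestor of `x,y` other than `v` is a
descendant of `v`. -/
def LSCApair {V : Type} (E : V → V → Prop) (x y : V) : Set V :=
  {v | v ∈ SCA E x y ∧ ∀ w ∈ SCA E x y, w ≠ v → w ∉ De E v}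

/-- The lowest strict common ancestors of a set `U` : nodes outside `U` that
are a lowest strict common ancestor of some pair of nodes of `U`. -/
def LSCAset {V : Type} (E : V → V → Prop) (U : Set V) : Set V :=
  {v | v ∉ U ∧ ∃ u ∈ U, ∃ u' ∈ U, v ∈ LSCApair E u u'}

/-- The `i`-th order LSCA set of `U`. -/
def lscaIter {V : Type} (E : V → V → Prop) (U : Set V) : ℕ → Set V
  | 0 => U
  | k + 1 => LSCAset E (lscaIter E U k) ∪ lscaIter E U k

/-- The LSCA closure `L∞(U)` of `U`.  (The sets `lscaIter E U i` are increasing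
in `i`, so on a finite node type this union equals `lscaIter E U k` for the
least `k` with `lscaIter E U k = lscaIter E U (k+1)`.) -/
def lscaClosure {V : Type} (E : V → V → Prop) (U : Set V) : Set V :=
  ⋃ k : ℕ, lscaIter E U k

/-! ## Λ-structures -/

/-- `(v, pa, pb)` is a Λ-structure over `(a, b)` : `pa` is a path from `v` to
`a`, `pb` is a path from `v` to `b`, and the two paths intersect only at `v`
(trivial paths are allowed). -/
def IsLambdaStruct {V : Type} (E : V → V → Prop) (v a b : V) (pa pb : List V) : Prop :=
  IsPath E v a pa ∧ IsPath E v b pb ∧ ∀ w ∈ pa, w ∈ pb → w = v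

/-- `Λ(U, W)` : the set of nodes forming a Λ-structure over `(U, W)`. -/
def LambdaSet {V : Type} (E : V → V → Prop) (U W : Set V) : Set V :=
  {v | ∃ u ∈ U, ∃ w ∈ W, ∃ pa pb : List V, IsLambdaStruct E v u w pa pb}

/-! ## Structural causal models -/

/-- A structural causal model over the graph with node type `V` and edge
relation `E` : each node `v` has a nonempty finite range `R v`, a nonempty
finite noise range `N v`, and a structural assignment `f v` computing the value
of `v` from the values of its parents and its noise value. -/
structure SCM (V : Type) (E : V → V → Prop) where
  R : V → Type
  rFin : ∀ v, Finite (R v)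
  rNe : ∀ v, Nonempty (R v)
  N : V → Type
  nFin : ∀ v, Finite (N v)
  nNe : ∀ v, Nonempty (N v)
  f : ∀ v : V, (∀ p : {p // E p v}, R p.1) → N v → R v

/-- Fuel-bounded approximation to the unrolled assignment. -/
noncomputable def approx {V : Type} {E : V → V → Prop} (scm : SCM V E)
    (n : ∀ v, scm.N v) : ℕ → ∀ v, scm.R v
  | 0 => fun v => (scm.rNe v).some
  | k + 1 => fun v => scm.f v (fun p => approx scm n k p.1) (n v)

/-- The unrolled assignment `f̄_v(n)` of an SCM over an acyclic graph: the value
of `v` obtained by recursively composing the structural assignments of the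
ancestors of `v`, evaluated at the unit `n`.  (On an acyclic graph every
directed path has fewer than `card V + 1` nodes, so this fuel value computes
the exact fixed point of the unrolling recursion
`f̄_v(n) = f_v((f̄_p(n))_{p ∈ Pa(v)}, n_v)`.) -/
noncomputable def unroll {V : Type} [Fintype V] {E : V → V → Prop} (scm : SCM V E)
    (n : ∀ v, scm.N v) (v : V) : scm.R v :=
  approx scm n (Fintype.card V + 1) v

/-- The atomic intervention `do(X = x)` : replace the structural assignment of
`X` by the constant function with value `x`. -/
noncomputable def SCM.intervene {V : Type} {E : V → V → Prop} (scm : SCM V E)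
    (X : V) (x : scm.R X) : SCM V E where
  R := scm.R
  rFin := scm.rFin
  rNe := scm.rNe
  N := scm.N
  nFin := scm.nFin
  nNe := scm.nNe
  f := fun v => if h : v = X then fun _ _ => h.symm ▸ x else scm.f v

/-- Fuel-bounded approximation to the blocked unrolled assignment. -/
noncomputable def blockApprox {V : Type} [Fintype V] {E : V → V → Prop} (scm : SCM V E)
    (B : V) (b : scm.R B) (n : ∀ v, scm.N v) : ℕ → ∀ v, scm.R v
  | 0 => fun v =>
      if h : v = B then h.symm ▸ b
      else if Relation.ReflTransGen E B v then (scm.rNe v).some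
      else unroll scm n v
  | k + 1 => fun v =>
      if h : v = B then h.symm ▸ b
      else if Relation.ReflTransGen E B v then
        scm.f v (fun p => blockApprox scm B b n k p.1) (n v)
      else unroll scm n v

/-- The blocked unrolled assignment `f̄_v[B](b, n)` : equal to `b` at `v = B`,
to the plain unrolled assignment `f̄_v(n)` if `v` is not a descendant of `B`,
and otherwise obtained by the unrolling recursion
`f̄_v[B](b,n) = f_v((f̄_p[B](b,n))_{p ∈ Pa(v)}, n_v)`. -/
noncomputable def blockUnroll {V : Type} [Fintype V] {E : V → V → Prop} (scm : SCM V E)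
    (B : V) (b : scm.R B) (n : ∀ v, scm.N v) (v : V) : scm.R v :=
  blockApprox scm B b n (Fintype.card V + 1) v

/-- The edge relation of the graph obtained after a conditional intervention on
`X` with conditioning set `A` : the parent set of `X` becomes `A`, and all
other edges are unchanged. -/
def condE {V : Type} (E : V → V → Prop) (X : V) (A : Set V) : V → V → Prop :=
  fun a b => (b = X ∧ a ∈ A) ∨ (b ≠ X ∧ E a b)

/-- The conditional intervention `do(X = g(A))` : replace the structural
assignment of `X` by the function that, given the values of the nodes in `A`,
outputs `g` of those values, so that `A` becomes the parent set of `X`. -/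
noncomputable def SCM.condIntervene {V : Type} {E : V → V → Prop} (scm : SCM V E)
    (X : V) (A : Set V) (g : (∀ a : A, scm.R a.1) → scm.R X) :
    SCM V (condE E X A) where
  R := scm.R
  rFin := scm.rFin
  rNe := scm.rNe
  N := scm.N
  nFin := scm.nFin
  nNe := scm.nNe
  f := fun v par nv =>
    if h : v = X then h.symm ▸ g (fun a => par ⟨a.1, Or.inl ⟨h, a.2⟩⟩)
    else scm.f v (fun p => par ⟨p.1, Or.inr ⟨h, p.2⟩⟩) nv

/-! ## Interventional superiority -/

/-- `X` is (deterministically atomic-interventionally) superior to `W` relative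
to `Y` : for every SCM over the graph in which the range of `Y` is linearly
ordered, and every unit `n`, there is `x ∈ R_X` such that for all `w ∈ R_W`,
`f̄_Y^{do(X=x)}(n) ≥ f̄_Y^{do(W=w)}(n)`. -/
def Superior {V : Type} [Fintype V] (E : V → V → Prop) (Y X W : V) : Prop :=
  ∀ (scm : SCM V E) (L : LinearOrder (scm.R Y)) (n : ∀ v, scm.N v),
    ∃ x : scm.R X, ∀ w : scm.R W,
      L.le (unroll (scm.intervene W w) n Y) (unroll (scm.intervene X x) n Y)

/-- Superiority for sets of nodes: `S ≽_Y T` iff every node of `T` is inferior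
to some node of `S`. -/
def SetSuperior {V : Type} [Fintype V] (E : V → V → Prop) (Y : V) (S T : Set V) : Prop :=
  ∀ W ∈ T, ∃ X ∈ S, Superior E Y X W

/-- A globally interventionally superior set (GISS) of the graph relative to
`Y` : a subset `U` of `V \ {Y}` with `U ≽_Y (V \ {Y}) \ U`. -/
def IsGISS {V : Type} [Fintype V] (E : V → V → Prop) (Y : V) (U : Set V) : Prop :=
  U ⊆ Set.univ \ {Y} ∧ SetSuperior E Y U ((Set.univ \ {Y}) \ U)

/-- A minimal globally interventionally superior set (mGISS): a GISS that is
minimal with respect to set inclusion. -/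
def IsMGISS {V : Type} [Fintype V] (E : V → V → Prop) (Y : V) (U : Set V) : Prop :=
  IsGISS E Y U ∧ ∀ U' : Set V, IsGISS E Y U' → U' ⊆ U → U' = U

section Paths

variable {V : Type} {E : V → V → Prop} {C : Set V} {a b x : V} {p : List V}

theorem isPath_singleton (a : V) : IsPath E a a [a] :=
  ⟨List.isChain_singleton a, rfl, rfl⟩

theorem IsPath.cons (h : E x a) (hp : IsPath E a b p) : IsPath E x b (x :: p) := by
  obtain ⟨hc, hh, hl⟩ := hp
  cases p with
  | nil => simp at hh
  | cons y q =>
    obtain rfl : y = a := by simpa using hh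
    exact ⟨List.isChain_cons_cons.2 ⟨h, hc⟩, rfl, by simpa using hl⟩

theorem IsPath.start_mem (hp : IsPath E a b p) : a ∈ p :=
  List.mem_of_mem_head? hp.2.1

/-- A path ending in `C` contains a first node of `C`. -/
theorem IsPath.exists_first_mem (hp : IsPath E a b p) (hb : b ∈ C) :
    ∃ t ∈ p, t ∈ C ∧ Relation.ReflTransGen (fun x y => E x y ∧ x ∉ C) a t ∧
      Relation.ReflTransGen E t b := by
  induction p generalizing a with
  | nil => simp [IsPath] at hp
  | cons y q ih =>
    obtain ⟨hc, hh, hl⟩ := hp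
    obtain rfl : y = a := by simpa using hh
    cases q with
    | nil =>
      obtain rfl : y = b := by simpa using hl
      exact ⟨y, by simp, hb, .refl, .refl⟩
    | cons z r =>
      obtain ⟨hyz, hc'⟩ := List.isChain_cons_cons.1 hc
      obtain ⟨t, htr, htC, h1, h2⟩ := ih (a := z) ⟨hc', rfl, by simpa using hl⟩
      by_cases hy : y ∈ C
      · have hzb : Relation.ReflTransGen E z b :=
          .trans (Relation.ReflTransGen.mono (fun _ _ h => h.1) _ _ h1) h2
        exact ⟨y, by simp, hy, .refl, .head hyz hzb⟩
      · exact ⟨t, List.mem_cons_of_mem _ htr, htC, .head ⟨hyz, hy⟩ h1, h2⟩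

theorem IsPath.reflTransGen (hp : IsPath E a b p) : Relation.ReflTransGen E a b := by
  obtain ⟨t, -, -, h1, h2⟩ := hp.exists_first_mem (Set.mem_univ b)
  exact .trans (Relation.ReflTransGen.mono (fun _ _ h => h.1) _ _ h1) h2

/-- A walk that leaves only nodes outside `C` gives a path meeting `C` at most in its end. -/
theorem exists_isPath_of_reflTransGen_compl
    (h : Relation.ReflTransGen (fun x y => E x y ∧ x ∉ C) a b) :
    ∃ p, IsPath E a b p ∧ ∀ x ∈ p, x ∈ C → x = b := by
  induction h using Relation.ReflTransGen.head_induction_on with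
  | refl => exact ⟨[b], isPath_singleton b, by simp⟩
  | head h _ ih =>
    obtain ⟨p, hp, hpC⟩ := ih
    refine ⟨_, hp.cons h.1, fun x hx hxC => ?_⟩
    rcases List.mem_cons.1 hx with rfl | hx
    · exact absurd hxC h.2
    · exact hpC x hx hxC

theorem exists_isPath_of_reflTransGen (h : Relation.ReflTransGen E a b) :
    ∃ p, IsPath E a b p := by
  obtain ⟨p, hp, -⟩ := exists_isPath_of_reflTransGen_compl (C := ∅)
    (Relation.ReflTransGen.mono (fun _ _ h => ⟨h, Set.notMem_empty _⟩) _ _ h)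
  exact ⟨p, hp⟩

end Paths

section Closure

variable {V : Type} {E : V → V → Prop} {U C : Set V}

theorem Acyclic.wellFounded_transGen [Finite V] (hacy : Acyclic E) :
    WellFounded (Relation.TransGen E) :=
  haveI : Std.Irrefl (Relation.TransGen E) := ⟨hacy⟩
  Finite.wellFounded_of_trans_of_irrefl _

theorem Acyclic.wellFounded_swap_transGen [Finite V] (hacy : Acyclic E) :
    WellFounded (Function.swap (Relation.TransGen E)) :=
  haveI : Std.Irrefl (Function.swap (Relation.TransGen E)) := ⟨hacy⟩
  haveI : IsTrans V (Function.swap (Relation.TransGen E)) := ⟨fun _ _ _ h h' => h'.trans h⟩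
  Finite.wellFounded_of_trans_of_irrefl _

theorem monotone_lscaIter (E : V → V → Prop) (U : Set V) : Monotone (lscaIter E U) :=
  monotone_nat_of_le_succ fun _ => Set.subset_union_right

theorem mem_lscaClosure_of_mem_LSCApair {a b v : V} (ha : a ∈ lscaClosure E U)
    (hb : b ∈ lscaClosure E U) (hv : v ∈ LSCApair E a b) : v ∈ lscaClosure E U := by
  obtain ⟨i, hi⟩ := Set.mem_iUnion.1 ha
  obtain ⟨j, hj⟩ := Set.mem_iUnion.1 hb
  refine Set.mem_iUnion.2 ⟨max i j + 1, ?_⟩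
  by_cases h : v ∈ lscaIter E U (max i j)
  · exact Or.inr h
  · exact Or.inl ⟨h, a, monotone_lscaIter E U (le_max_left i j) hi,
      b, monotone_lscaIter E U (le_max_right i j) hj, hv⟩

theorem lscaClosure_eq_self (hC : ∀ a ∈ C, ∀ b ∈ C, LSCApair E a b ⊆ C) :
    lscaClosure E C = C := by
  have h : ∀ k, lscaIter E C k = C := by
    intro k
    induction k with
    | zero => rfl
    | succ k ih =>
      rw [lscaIter, ih, Set.union_eq_right]
      rintro v ⟨-, a, ha, b, hb, hv⟩
      exact hC a ha b hb hv
  simp only [lscaClosure, h, Set.iUnion_const]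

/-- Below every strict common ancestor there is a lowest one. -/
theorem exists_mem_LSCApair_of_mem_SCA [Finite V] (hacy : Acyclic E) {a b v : V}
    (hv : v ∈ SCA E a b) : ∃ w ∈ LSCApair E a b, Relation.ReflTransGen E v w := by
  obtain ⟨w, ⟨hw, hvw⟩, hmin⟩ := hacy.wellFounded_swap_transGen.has_min
    {w | w ∈ SCA E a b ∧ Relation.ReflTransGen E v w} ⟨v, hv, .refl⟩
  refine ⟨w, ⟨hw, fun x hx hxw hwx => ?_⟩, hvw⟩
  rcases Relation.reflTransGen_iff_eq_or_transGen.1 hwx with h | h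
  · exact hxw h
  · exact hmin x ⟨hx, hvw.trans hwx⟩ h

/-- A set closed under lowest strict common ancestors of pairs contains every node
forming a Λ-structure over it. -/
theorem LambdaSet_subset_of_LSCApair_subset [Finite V] (hacy : Acyclic E)
    (hC : ∀ a ∈ C, ∀ b ∈ C, LSCApair E a b ⊆ C) : LambdaSet E C C ⊆ C := by
  rintro v ⟨u, hu, u', hu', pa, pb, hpa, hpb, hab⟩
  by_contra hvC
  let T : Set V := {t | t ∈ C ∧ Relation.ReflTransGen (fun x y => E x y ∧ x ∉ C) v t}
  obtain ⟨s, hspa, hsC, hvs, -⟩ := hpa.exists_first_mem hu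
  obtain ⟨t, htpb, htC, hvt, -⟩ := hpb.exists_first_mem hu'
  have hst : s ≠ t := by
    rintro rfl
    exact hvC (hab s hspa htpb ▸ hsC)
  obtain ⟨a, ⟨haC, hva⟩, hmin⟩ := hacy.wellFounded_transGen.has_min T ⟨s, hsC, hvs⟩
  obtain ⟨b, ⟨hbC, hvb⟩, hba⟩ : ∃ b ∈ T, b ≠ a := by
    by_cases h : s = a
    · exact ⟨t, ⟨htC, hvt⟩, fun h' => hst (h.trans h'.symm)⟩
    · exact ⟨s, ⟨hsC, hvs⟩, h⟩
  obtain ⟨p, hp, hpC⟩ := exists_isPath_of_reflTransGen_compl hva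
  obtain ⟨q, hq, hqC⟩ := exists_isPath_of_reflTransGen_compl hvb
  have hv : v ∈ SCA E a b :=
    ⟨⟨p, hp, fun h => hba (hpC b h hbC)⟩, ⟨q, hq, fun h => hba (hqC a h haC).symm⟩⟩
  obtain ⟨w, hw, hvw⟩ := exists_mem_LSCApair_of_mem_SCA hacy hv
  obtain ⟨r, hr⟩ := exists_isPath_of_reflTransGen hvw
  obtain ⟨z, -, hzC, hvz, hzw⟩ := hr.exists_first_mem (hC a haC b hbC hw)
  obtain ⟨⟨⟨p', hp', -⟩, ⟨q', hq', haq'⟩⟩, -⟩ := hw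
  have hwa : Relation.TransGen E w a := by
    rcases Relation.reflTransGen_iff_eq_or_transGen.1 hp'.reflTransGen with h | h
    · exact absurd (h ▸ hq'.start_mem) haq'
    · exact h
  exact hmin z ⟨hzC, hvz⟩ (hwa.trans_right hzw)

end Closure

/-- For every finite DAG `G = (V, E)` and every subset
`U ⊆ V`, the LSCA closure is idempotent, `L∞(L∞(U)) = L∞(U)`; consequently, a
node `v` belongs to `L∞(U)` if and only if `v` forms a Λ-structure over
`(L∞(U), L∞(U))`. -/
theorem lscaClosure_idem_and_mem_iff_lambda {V : Type} [Fintype V] (E : V → V → Prop)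
    (hacy : Acyclic E) (U : Set V) :
    lscaClosure E (lscaClosure E U) = lscaClosure E U ∧
    ∀ v : V, v ∈ lscaClosure E U ↔
      v ∈ LambdaSet E (lscaClosure E U) (lscaClosure E U) := by
  have hC : ∀ a ∈ lscaClosure E U, ∀ b ∈ lscaClosure E U,
      LSCApair E a b ⊆ lscaClosure E U :=
    fun _ ha _ hb _ hv => mem_lscaClosure_of_mem_LSCApair ha hb hv
  refine ⟨lscaClosure_eq_self hC, fun v => ⟨fun hv => ?_, fun hv =>
    LambdaSet_subset_of_LSCApair_subset hacy hC hv⟩⟩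
  exact ⟨v, hv, v, hv, [v], [v], isPath_singleton v, isPath_singleton v, by simp⟩
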